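/- There exists a constant K' > 0 depending only on V such that: if 0 < ε ≤ 1, y ∈ ℝ, s > 0 with s ≥ ε², and v_ε is a smooth solution of ∂_t v_ε − ∂_xx v_ε = −ε⁻²∇V(v_ε) on the cylinder [y − ε, y + ε] × [s − ε², s] taking values in B(σ_i, μ₀) for some i ∈ {1,…,q} on that cylinder, then ε⁴ |∂_t v_ε(y,s)|² + ε e_ε(v_ε(y,s)) ≤ K' ε⁻² ∫_{s−ε²}^{s} ∫_{y−ε}^{y+ε} e_ε(v_ε(z,τ)) dz dτ. -/

import Mathlib

open MeasureTheory Metric Set Filter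
open scoped RealInnerProductSpace Pointwise Topology

noncomputable section

abbrev Euc (k : ℕ) : Type := EuclideanSpace ℝ (Fin k)

/-- A smooth non-degenerate multiple-well potential with wells of equal depth (zero),
satisfying assumptions (H1), (H2), (H3) of the paper. `lamm σ` / `lamp σ` are the
smallest / largest eigenvalues of the Hessian `∇²V(σ)` at a well `σ`. -/
structure MultiWell (k : ℕ) where
  V : Euc k → ℝ
  wells : Finset (Euc k)
  lamm : Euc k → ℝ
  lamp : Euc k → ℝ
  smooth : ContDiff ℝ (⊤ : ℕ∞) V
  nonneg : ∀ y, 0 ≤ V y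
  zero_iff : ∀ y, V y = 0 ↔ y ∈ wells
  two_le_card : 2 ≤ wells.card
  lamm_pos : ∀ σ ∈ wells, 0 < lamm σ
  hess_lower : ∀ σ ∈ wells, ∀ w : Euc k,
    lamm σ * ‖w‖ ^ 2 ≤ iteratedFDeriv ℝ 2 V σ ![w, w]
  hess_upper : ∀ σ ∈ wells, ∀ w : Euc k,
    iteratedFDeriv ℝ 2 V σ ![w, w] ≤ lamp σ * ‖w‖ ^ 2
  coercive : ∃ α > (0:ℝ), ∃ R₀ > (0:ℝ), ∀ y : Euc k, R₀ < ‖y‖ →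
    α * ‖y‖ ^ 2 ≤ ⟪y, gradient V y⟫

variable {k : ℕ}

/-- `μ₀` is small enough: the balls `B(σ, μ₀)` are pairwise disjoint and on each of them
the Hessian of `V` is controlled from below by `λ⁻/2` and from above by `2λ⁺`. -/
def GoodRadius (P : MultiWell k) (μ₀ : ℝ) : Prop :=
  0 < μ₀ ∧
  (∀ σ ∈ P.wells, ∀ σ' ∈ P.wells, σ ≠ σ' → Disjoint (ball σ μ₀) (ball σ' μ₀)) ∧
  (∀ σ ∈ P.wells, ∀ y ∈ ball σ μ₀, ∀ w : Euc k,
    P.lamm σ / 2 * ‖w‖ ^ 2 ≤ iteratedFDeriv ℝ 2 P.V y ![w, w] ∧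
    iteratedFDeriv ℝ 2 P.V y ![w, w] ≤ 2 * P.lamp σ * ‖w‖ ^ 2)

/-- Rescaled energy density `e_ε(u) = ε|u'|²/2 + V(u)/ε`. -/
def eDen (P : MultiWell k) (ε : ℝ) (u : ℝ → Euc k) (x : ℝ) : ℝ :=
  ε * ‖deriv u x‖ ^ 2 / 2 + P.V (u x) / ε

/-- Total energy `E_ε(u) = ∫_ℝ e_ε(u)`. -/
def energy (P : MultiWell k) (ε : ℝ) (u : ℝ → Euc k) : ℝ := ∫ x, eDen P ε u x

/-- Discrepancy `ξ_ε(u) = ε|u'|²/2 − V(u)/ε`. -/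
def discrep (P : MultiWell k) (ε : ℝ) (u : ℝ → Euc k) (x : ℝ) : ℝ :=
  ε * ‖deriv u x‖ ^ 2 / 2 - P.V (u x) / ε

/-- The front set `D(u) = {x : dist(u(x), Σ) ≥ μ₀}`. -/
def frontSet (P : MultiWell k) (μ₀ : ℝ) (u : ℝ → Euc k) : Set ℝ :=
  {x : ℝ | μ₀ ≤ infDist (u x) (P.wells : Set (Euc k))}

/-- The clearing-out property for the constant `η₀` at scale `ε`: on any interval of length
`≥ ε` on which the energy is at most `η₀`, the map stays `μ₀`-close to the wells. -/
def ClearingOut (P : MultiWell k) (μ₀ η₀ ε : ℝ) : Prop :=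
  ∀ u : ℝ → Euc k, ContDiff ℝ 1 u → ∀ a b : ℝ, ε ≤ b - a →
    (∫ x in a..b, eDen P ε u x) ≤ η₀ →
    ∀ x ∈ Icc a b, infDist (u x) (P.wells : Set (Euc k)) < μ₀

/-- `v` is a (globally defined) smooth solution of `∂ₜ v − ∂ₓₓ v = −ε⁻² ∇V(v)`. -/
def IsSolution (P : MultiWell k) (ε : ℝ) (v : ℝ → ℝ → Euc k) : Prop :=
  ContDiff ℝ (⊤ : ℕ∞) (Function.uncurry v) ∧
  ∀ t x : ℝ, 0 < t →
    deriv (fun s => v s x) t - iteratedDeriv 2 (v t) x = -(ε ^ 2)⁻¹ • gradient P.V (v t x)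

/-- `(J, ρ)` is a `κ`-confined covering of `S` at scale `ρ`. -/
def IsConfCover {X : Type*} [MetricSpace X] (S : Set X) (J : Finset X) (κ ρ : ℝ) : Prop :=
  (S ⊆ ⋃ a ∈ J, ball a (κ * ρ)) ∧
  (∀ a ∈ J, (S ∩ ball a (κ * ρ)).Nonempty) ∧
  (∀ a ∈ J, ∀ b ∈ J, a ≠ b → κ⁻¹ * ρ ≤ dist a b)

section

variable {E : Type*} [NormedAddCommGroup E] [InnerProductSpace ℝ E]
variable {F : Type*} [NormedAddCommGroup F] [NormedSpace ℝ F]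

/-- Weighted Young inequality for inner products. -/
lemma mul_inner_le_young (b c : ℝ) (x y : E) :
    c * b * ⟪x, y⟫ ≤ c ^ 2 * ‖x‖ ^ 2 / 2 + b ^ 2 * ‖y‖ ^ 2 / 2 := by
  have h := sq_nonneg (‖c • x - b • y‖)
  rw [norm_sub_sq_real, norm_smul, norm_smul, real_inner_smul_left, real_inner_smul_right,
    mul_pow, mul_pow, Real.norm_eq_abs, Real.norm_eq_abs, sq_abs, sq_abs] at h
  linarith

lemma dissipation_bound {Λ K₁ K₂ θ η d v : ℝ} {a p q r h : E}
    (hθ : 0 ≤ θ) (hθ1 : θ ≤ 1) (hη : 0 ≤ η) (hη1 : η ≤ 1) (hd : d ^ 2 ≤ 16) (hv : 0 ≤ v)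
    (hh : ‖h‖ ≤ Λ * ‖p‖) (hΛ : 0 ≤ Λ) (hK₂ : K₂ = 580)
    (hK₁ : K₁ = 2 * (580 * (129 + Λ) + Λ ^ 2)) :
    K₁ * (η ^ 2 * (‖a‖ ^ 2 / 2 + v) - 2 * θ * η * d * ⟪a, p⟫ - θ * η ^ 2 * ‖p‖ ^ 2)
      + K₂ * (θ * η ^ 4 * ‖p‖ ^ 2 - 4 * θ ^ 2 * η ^ 3 * d * ⟪p, q⟫ - θ ^ 2 * η ^ 4 * ‖q‖ ^ 2
        - θ ^ 2 * η ^ 4 * ⟪p, h⟫)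
      + (3 / 2 * θ ^ 2 * η ^ 6 * ‖q‖ ^ 2 - 6 * θ ^ 3 * η ^ 5 * d * ⟪q, r⟫
        - θ ^ 3 * η ^ 6 * ‖r‖ ^ 2 - θ ^ 3 * η ^ 6 * ⟪h, r⟫)
      ≤ 65 * K₁ * (‖a‖ ^ 2 / 2 + v) := by
  have hη2 : η ^ 2 ≤ 1 := pow_le_one₀ hη hη1
  have hη4 : η ^ 4 ≤ η ^ 2 := pow_le_pow_of_le_one hη hη1 (by norm_num)
  have hη6 : η ^ 6 ≤ η ^ 4 := pow_le_pow_of_le_one hη hη1 (by norm_num)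
  have hη6' : η ^ 6 ≤ η ^ 2 := pow_le_pow_of_le_one hη hη1 (by norm_num)
  have hθ2 : θ ^ 2 ≤ θ := by simpa using pow_le_pow_of_le_one hθ hθ1 (show 1 ≤ 2 by norm_num)
  have hθ3 : θ ^ 3 ≤ θ ^ 2 := pow_le_pow_of_le_one hθ hθ1 (by norm_num)
  have hθ3' : θ ^ 3 ≤ θ := by simpa using pow_le_pow_of_le_one hθ hθ1 (show 1 ≤ 3 by norm_num)
  have hK₁0 : 0 ≤ K₁ := by rw [hK₁]; positivity
  set X := θ * η ^ 2 * ‖p‖ ^ 2 with hX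
  set Y := θ ^ 2 * η ^ 4 * ‖q‖ ^ 2 with hY
  have hX0 : 0 ≤ X := by positivity
  have hY0 : 0 ≤ Y := by positivity
  have h1 : η ^ 2 * (‖a‖ ^ 2 / 2 + v) - 2 * θ * η * d * ⟪a, p⟫ - X
      ≤ 65 * (‖a‖ ^ 2 / 2 + v) - X / 2 := by
    have y1 := mul_le_mul_of_nonneg_left (mul_inner_le_young η (-2 * d) a p) hθ
    have y2 : θ * (d ^ 2 * ‖a‖ ^ 2) ≤ 1 * (16 * ‖a‖ ^ 2) := by gcongr
    have y3 : η ^ 2 * (‖a‖ ^ 2 / 2 + v) ≤ 1 * (‖a‖ ^ 2 / 2 + v) := by gcongr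
    linarith
  have hph : -⟪p, h⟫ ≤ Λ * ‖p‖ ^ 2 := by
    have := neg_le_of_abs_le (abs_real_inner_le_norm p h)
    nlinarith [norm_nonneg p]
  have h2 : θ * η ^ 4 * ‖p‖ ^ 2 - 4 * θ ^ 2 * η ^ 3 * d * ⟪p, q⟫ - Y - θ ^ 2 * η ^ 4 * ⟪p, h⟫
      ≤ (129 + Λ) * X - Y / 2 := by
    have y1 := mul_le_mul_of_nonneg_left (mul_inner_le_young η (-4 * d) p q)
      (show 0 ≤ θ ^ 2 * η ^ 2 by positivity)
    have y2 : (θ ^ 2 * η ^ 2) * (d ^ 2 * ‖p‖ ^ 2) ≤ (θ * η ^ 2) * (16 * ‖p‖ ^ 2) := by gcongr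
    have y3 : θ * η ^ 4 * ‖p‖ ^ 2 ≤ X := by rw [hX]; gcongr
    have y4 : θ ^ 2 * η ^ 4 * (-⟪p, h⟫) ≤ θ ^ 2 * η ^ 4 * (Λ * ‖p‖ ^ 2) := by gcongr
    have y5 : θ ^ 2 * η ^ 4 * (Λ * ‖p‖ ^ 2) ≤ θ * η ^ 2 * (Λ * ‖p‖ ^ 2) := by gcongr
    linarith
  have hh2 : ‖h‖ ^ 2 ≤ Λ ^ 2 * ‖p‖ ^ 2 := by
    rw [← mul_pow]; exact pow_le_pow_left₀ (norm_nonneg _) hh 2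
  have h3 : 3 / 2 * θ ^ 2 * η ^ 6 * ‖q‖ ^ 2 - 6 * θ ^ 3 * η ^ 5 * d * ⟪q, r⟫
        - θ ^ 3 * η ^ 6 * ‖r‖ ^ 2 - θ ^ 3 * η ^ 6 * ⟪h, r⟫ ≤ 290 * Y + Λ ^ 2 * X := by
    have y1 := mul_le_mul_of_nonneg_left (mul_inner_le_young η (-6 * d) q r)
      (show 0 ≤ θ ^ 3 * η ^ 4 by positivity)
    have y2 : (θ ^ 3 * η ^ 4) * (d ^ 2 * ‖q‖ ^ 2) ≤ (θ ^ 2 * η ^ 4) * (16 * ‖q‖ ^ 2) := by gcongr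
    have y3 : θ ^ 2 * η ^ 6 * ‖q‖ ^ 2 ≤ Y := by rw [hY]; gcongr
    have y4 := mul_le_mul_of_nonneg_left (mul_inner_le_young 1 (-1) h r)
      (show 0 ≤ θ ^ 3 * η ^ 6 by positivity)
    have y5 : (θ ^ 3 * η ^ 6) * ‖h‖ ^ 2 ≤ (θ * η ^ 2) * (Λ ^ 2 * ‖p‖ ^ 2) := by gcongr
    have y6 : 0 ≤ Λ ^ 2 * X := by positivity
    linarith
  have h1' := mul_le_mul_of_nonneg_left h1 hK₁0
  have h2' := mul_le_mul_of_nonneg_left h2 (show 0 ≤ K₂ by rw [hK₂]; norm_num)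
  have h4 : K₁ * X = 2 * (580 * (129 + Λ) + Λ ^ 2) * X := by rw [hK₁]
  have h5 := hK₂
  subst h5
  linarith [mul_nonneg (sq_nonneg Λ) hX0]

lemma slice_bound {c Λ K₁ K₂ θ η d v : ℝ} {u a p q g : E}
    (hθ : 1 / 4 ≤ θ) (hη : 0 ≤ η) (hη1 : η ≤ 1) (hd : |d| ≤ 4)
    (hc : 0 < c) (huv : c * ‖u‖ ^ 2 ≤ v)
    (hg : ‖g‖ ≤ Λ * ‖u‖) (hK₁ : 1 ≤ K₁) (hK₂ : 1 ≤ K₂) :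
    -(6 * η ^ 5 * d * (‖u‖ ^ 2 + ‖a‖ ^ 2 + ‖p‖ ^ 2)
      + 2 * η ^ 6 * (⟪u, a⟫ + ⟪a, p + g⟫ + ⟪p, q⟫))
      ≤ 64 * (60 + (30 + Λ ^ 2) / c) *
        (K₁ * θ * η ^ 2 * (‖a‖ ^ 2 / 2 + v) + K₂ * θ ^ 2 * η ^ 4 * (‖p‖ ^ 2 / 2)
          + θ ^ 3 * η ^ 6 * (‖q‖ ^ 2 / 2)) := by
  have hv : 0 ≤ v := le_trans (by positivity) huv
  have hη54 : η ^ 5 ≤ η ^ 4 := pow_le_pow_of_le_one hη hη1 (by norm_num)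
  have hη52 : η ^ 5 ≤ η ^ 2 := pow_le_pow_of_le_one hη hη1 (by norm_num)
  have hη64 : η ^ 6 ≤ η ^ 4 := pow_le_pow_of_le_one hη hη1 (by norm_num)
  have hη62 : η ^ 6 ≤ η ^ 2 := pow_le_pow_of_le_one hη hη1 (by norm_num)
  have hθ2 : (1 / 4) ^ 2 ≤ θ ^ 2 := pow_le_pow_left₀ (by norm_num) hθ 2
  have hθ3 : (1 / 4) ^ 3 ≤ θ ^ 3 := pow_le_pow_left₀ (by norm_num) hθ 3
  have hθ0 : 0 ≤ θ := by linarith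
  have huv' : ‖u‖ ^ 2 ≤ v / c := by rw [le_div_iff₀ hc]; linarith
  set A := η ^ 2 * (‖a‖ ^ 2 / 2 + v) with hA
  set X := η ^ 4 * (‖p‖ ^ 2 / 2) with hX
  set Y := η ^ 6 * (‖q‖ ^ 2 / 2) with hY
  have hA0 : 0 ≤ A := by positivity
  have hX0 : 0 ≤ X := by positivity
  have hY0 : 0 ≤ Y := by positivity
  have hG : A + X + Y ≤ 64 * (K₁ * θ * A + K₂ * θ ^ 2 * X + θ ^ 3 * Y) := by
    have e1 : 1 * (1 / 4) * A ≤ K₁ * θ * A := by gcongr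
    have e2 : 1 * (1 / 4) ^ 2 * X ≤ K₂ * θ ^ 2 * X := by gcongr
    have e3 : (1 / 4) ^ 3 * Y ≤ θ ^ 3 * Y := by gcongr
    linarith
  have hg2 : ‖g‖ ^ 2 ≤ Λ ^ 2 * ‖u‖ ^ 2 := by
    rw [← mul_pow]; exact pow_le_pow_left₀ (norm_nonneg _) hg 2
  have b1 := mul_inner_le_young 1 (-1) u a
  have b2 := mul_inner_le_young 1 (-1) a p
  have b3 := mul_inner_le_young 1 (-1) a g
  have b4 := mul_inner_le_young 1 (-1) p q
  have hd' : -d ≤ 4 := by linarith [neg_abs_le d]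
  have c1 : -(6 * η ^ 5 * d * (‖u‖ ^ 2 + ‖a‖ ^ 2 + ‖p‖ ^ 2))
      ≤ 24 * (η ^ 5 * (‖u‖ ^ 2 + ‖a‖ ^ 2)) + 24 * (η ^ 5 * ‖p‖ ^ 2) := by
    have := mul_le_mul_of_nonneg_left hd'
      (show 0 ≤ 6 * η ^ 5 * (‖u‖ ^ 2 + ‖a‖ ^ 2 + ‖p‖ ^ 2) by positivity)
    linarith
  have c2 : η ^ 5 * (‖u‖ ^ 2 + ‖a‖ ^ 2) ≤ η ^ 2 * (‖u‖ ^ 2 + ‖a‖ ^ 2) := by gcongr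
  have c3 : η ^ 5 * ‖p‖ ^ 2 ≤ η ^ 4 * ‖p‖ ^ 2 := by gcongr
  have c4 : -(⟪u, a⟫ + ⟪a, p + g⟫ + ⟪p, q⟫) * 2 ≤ (1 + Λ ^ 2) * ‖u‖ ^ 2 + 3 * ‖a‖ ^ 2 + 2 * ‖p‖ ^ 2
      + ‖q‖ ^ 2 := by
    rw [inner_add_right]; linarith
  have c5 := mul_le_mul_of_nonneg_left c4 (show 0 ≤ η ^ 6 by positivity)
  have c6 : η ^ 6 * ((1 + Λ ^ 2) * ‖u‖ ^ 2 + 3 * ‖a‖ ^ 2)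
      ≤ η ^ 2 * ((1 + Λ ^ 2) * ‖u‖ ^ 2 + 3 * ‖a‖ ^ 2) := by gcongr
  have c7 : η ^ 6 * ‖p‖ ^ 2 ≤ η ^ 4 * ‖p‖ ^ 2 := by gcongr
  have c8 : η ^ 2 * ((25 + Λ ^ 2) * ‖u‖ ^ 2) ≤ (30 + Λ ^ 2) / c * A := by
    have : (25 + Λ ^ 2) * ‖u‖ ^ 2 ≤ (30 + Λ ^ 2) / c * (‖a‖ ^ 2 / 2 + v) := by
      calc (25 + Λ ^ 2) * ‖u‖ ^ 2 ≤ (30 + Λ ^ 2) * ((‖a‖ ^ 2 / 2 + v) / c) := by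
            gcongr
            · norm_num
            · refine huv'.trans ?_
              gcongr
              nlinarith [sq_nonneg ‖a‖]
        _ = _ := by ring
    calc _ ≤ η ^ 2 * ((30 + Λ ^ 2) / c * (‖a‖ ^ 2 / 2 + v)) := by gcongr
      _ = _ := by rw [hA]; ring
  have c9 : η ^ 2 * ‖a‖ ^ 2 ≤ 2 * A := by
    have := mul_nonneg (sq_nonneg η) hv
    rw [hA]; linarith
  have hCc : 0 ≤ (30 + Λ ^ 2) / c := by positivity
  have fin : -(6 * η ^ 5 * d * (‖u‖ ^ 2 + ‖a‖ ^ 2 + ‖p‖ ^ 2)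
      + 2 * η ^ 6 * (⟪u, a⟫ + ⟪a, p + g⟫ + ⟪p, q⟫))
      ≤ (60 + (30 + Λ ^ 2) / c) * (A + X + Y) := by
    have := mul_nonneg hCc hX0
    have := mul_nonneg hCc hY0
    linarith
  calc _ ≤ (60 + (30 + Λ ^ 2) / c) * (A + X + Y) := fin
    _ ≤ (60 + (30 + Λ ^ 2) / c) * (64 * (K₁ * θ * A + K₂ * θ ^ 2 * X + θ ^ 3 * Y)) := by gcongr
    _ = _ := by simp only [hA, hX, hY]; ring

/-- Derivative of a function on the plane in the constant direction `e`. -/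
def dirDeriv (e : ℝ × ℝ) (f : ℝ × ℝ → F) (z : ℝ × ℝ) : F := fderiv ℝ f z e

lemma ContDiffOn.dirDeriv {f : ℝ × ℝ → F} {Ω : Set (ℝ × ℝ)} (hΩ : IsOpen Ω)
    (hf : ContDiffOn ℝ (⊤ : ℕ∞) f Ω) (e : ℝ × ℝ) :
    ContDiffOn ℝ (⊤ : ℕ∞) (dirDeriv e f) Ω :=
  (hf.fderiv_of_isOpen hΩ (by simp)).clm_apply contDiffOn_const

lemma dirDeriv_comm {f : ℝ × ℝ → F} {z : ℝ × ℝ} (hf : ContDiffAt ℝ (⊤ : ℕ∞) f z)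
    (e e' : ℝ × ℝ) : dirDeriv e (dirDeriv e' f) z = dirDeriv e' (dirDeriv e f) z := by
  have hd : DifferentiableAt ℝ (fderiv ℝ f) z :=
    (hf.fderiv_right (m := 1) (WithTop.coe_le_coe.2 le_top)).differentiableAt (by norm_num)
  have key : ∀ v w : ℝ × ℝ, dirDeriv v (dirDeriv w f) z = fderiv ℝ (fderiv ℝ f) z v w := by
    intro v w
    have := (hd.hasFDerivAt.clm_apply (hasFDerivAt_const w z)).fderiv
    unfold dirDeriv
    rw [this]
    simp
  rw [key, key]
  exact hf.isSymmSndFDerivAt (by simpa using WithTop.coe_le_coe.2 (le_top : (2 : ℕ∞) ≤ ⊤)) e e'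

lemma hasDerivAt_fst_slice {f : ℝ × ℝ → F} {t x : ℝ} (hf : DifferentiableAt ℝ f (t, x)) :
    HasDerivAt (fun τ => f (τ, x)) (dirDeriv (1, 0) f (t, x)) t :=
  hf.hasFDerivAt.comp_hasDerivAt t ((hasDerivAt_id t).prodMk (hasDerivAt_const t x))

lemma hasDerivAt_snd_slice {f : ℝ × ℝ → F} {t x : ℝ} (hf : DifferentiableAt ℝ f (t, x)) :
    HasDerivAt (fun ξ => f (t, ξ)) (dirDeriv (0, 1) f (t, x)) x :=
  hf.hasFDerivAt.comp_hasDerivAt x ((hasDerivAt_const x t).prodMk (hasDerivAt_id x))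

lemma integral_slice_le_of_divergence_le {G H f : ℝ × ℝ → ℝ} {Ω : Set (ℝ × ℝ)} (hΩ : IsOpen Ω)
    (hG : ContDiffOn ℝ (⊤ : ℕ∞) G Ω) (hH : ContDiffOn ℝ (⊤ : ℕ∞) H Ω) (hf : ContinuousOn f Ω)
    {t₀ T a b : ℝ} (hT : t₀ ≤ T) (hab : a ≤ b) (hsub : Icc t₀ T ×ˢ Icc a b ⊆ Ω)
    (hle : ∀ z ∈ Icc t₀ T ×ˢ Icc a b, dirDeriv (1, 0) G z - dirDeriv (0, 1) H z ≤ f z)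
    (hG0 : ∀ x, G (t₀, x) = 0) (hHa : ∀ t, H (t, a) = 0) (hHb : ∀ t, H (t, b) = 0) :
    ∫ x in a..b, G (T, x) ≤ ∫ z in Icc t₀ T ×ˢ Icc a b, f z := by
  have hIcc : Icc ((t₀, a) : ℝ × ℝ) (T, b) = Icc t₀ T ×ˢ Icc a b := Icc_prod_eq _ _
  have hcomp : IsCompact (Icc t₀ T ×ˢ Icc a b) := isCompact_Icc.prod isCompact_Icc
  have hcont : ContinuousOn (fun z => dirDeriv (1, 0) G z + -dirDeriv (0, 1) H z)
      (Icc t₀ T ×ˢ Icc a b) :=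
    (((hG.dirDeriv hΩ _).continuousOn).add ((hH.dirDeriv hΩ _).continuousOn).neg).mono hsub
  have hsub' : Ioo t₀ T ×ˢ Ioo a b ⊆ Ω :=
    (Set.prod_mono Ioo_subset_Icc_self Ioo_subset_Icc_self).trans hsub
  have key := integral_divergence_prod_Icc_of_hasFDerivAt_off_countable_of_le
    G (fun z => -H z) (fderiv ℝ G) (fun z => -fderiv ℝ H z) (t₀, a) (T, b) ⟨hT, hab⟩ ∅
    countable_empty (by rw [hIcc]; exact hG.continuousOn.mono hsub)
    (by rw [hIcc]; exact (hH.continuousOn.mono hsub).neg)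
    (fun z hz => ((hG.contDiffAt (hΩ.mem_nhds (hsub' hz.1))).differentiableAt
      (by simp)).hasFDerivAt)
    (fun z hz => ((hH.contDiffAt (hΩ.mem_nhds (hsub' hz.1))).differentiableAt
      (by simp)).hasFDerivAt.neg)
    (by rw [hIcc]; exact hcont.integrableOn_compact hcomp)
  simp only [hIcc, hHa, hHb, hG0, neg_zero, intervalIntegral.integral_zero, sub_zero,
    zero_add] at key
  rw [← key]
  refine setIntegral_mono_on (hcont.integrableOn_compact hcomp)
    ((hf.mono hsub).integrableOn_compact hcomp) hcomp.measurableSet fun z hz => ?_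
  have := hle z hz
  simp only [dirDeriv] at this
  simpa [sub_eq_add_neg] using this

/-- The cylinder `(-1, 0) × (-1, 1)`, time being the first coordinate. -/
def unitCyl : Set (ℝ × ℝ) := Ioo (-1) 0 ×ˢ Ioo (-1) 1

lemma isOpen_unitCyl : IsOpen unitCyl := isOpen_Ioo.prod isOpen_Ioo

/-- Localized higher-order energy density of a map `W` on space-time. -/
def locDensity (K₁ K₂ : ℝ) (V : E → ℝ) (W : ℝ × ℝ → E) (z : ℝ × ℝ) : ℝ :=
  K₁ * (z.1 + 1 / 2) * (1 - 4 * z.2 ^ 2) ^ 2 * (‖dirDeriv (0, 1) W z‖ ^ 2 / 2 + V (W z))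
    + K₂ * (z.1 + 1 / 2) ^ 2 * (1 - 4 * z.2 ^ 2) ^ 4 * (‖dirDeriv (1, 0) W z‖ ^ 2 / 2)
    + (z.1 + 1 / 2) ^ 3 * (1 - 4 * z.2 ^ 2) ^ 6
      * (‖dirDeriv (0, 1) (dirDeriv (1, 0) W) z‖ ^ 2 / 2)

/-- The spatial flux associated with `locDensity`. -/
def locFlux (K₁ K₂ : ℝ) (W : ℝ × ℝ → E) (z : ℝ × ℝ) : ℝ :=
  K₁ * (z.1 + 1 / 2) * (1 - 4 * z.2 ^ 2) ^ 2 * ⟪dirDeriv (0, 1) W z, dirDeriv (1, 0) W z⟫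
    + K₂ * (z.1 + 1 / 2) ^ 2 * (1 - 4 * z.2 ^ 2) ^ 4
      * ⟪dirDeriv (1, 0) W z, dirDeriv (0, 1) (dirDeriv (1, 0) W) z⟫
    + (z.1 + 1 / 2) ^ 3 * (1 - 4 * z.2 ^ 2) ^ 6
      * ⟪dirDeriv (0, 1) (dirDeriv (1, 0) W) z, dirDeriv (1, 0) (dirDeriv (1, 0) W) z⟫

section
variable {K₁ K₂ : ℝ} {V : E → ℝ} {g : E → E} {W : ℝ × ℝ → E}

lemma contDiffOn_locDensity (hV : ContDiff ℝ (⊤ : ℕ∞) V)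
    (hW : ContDiffOn ℝ (⊤ : ℕ∞) W unitCyl) :
    ContDiffOn ℝ (⊤ : ℕ∞) (locDensity K₁ K₂ V W) unitCyl := by
  have ha := hW.dirDeriv isOpen_unitCyl (0, 1)
  have hp := hW.dirDeriv isOpen_unitCyl (1, 0)
  have hq := hp.dirDeriv isOpen_unitCyl (0, 1)
  have hVW := hV.comp_contDiffOn hW
  unfold locDensity
  have h1 : ContDiffOn ℝ (⊤ : ℕ∞) (fun z : ℝ × ℝ => z.1 + 1 / 2) unitCyl :=
    (contDiff_fst.add contDiff_const).contDiffOn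
  have h2 : ContDiffOn ℝ (⊤ : ℕ∞) (fun z : ℝ × ℝ => 1 - 4 * z.2 ^ 2) unitCyl :=
    (contDiff_const.sub (contDiff_const.mul (contDiff_snd.pow 2))).contDiffOn
  exact ((((contDiffOn_const.mul h1).mul (h2.pow 2)).mul
    (((ha.norm_sq ℝ).div_const 2).add hVW)).add
    (((contDiffOn_const.mul (h1.pow 2)).mul (h2.pow 4)).mul ((hp.norm_sq ℝ).div_const 2))).add
    (((h1.pow 3).mul (h2.pow 6)).mul ((hq.norm_sq ℝ).div_const 2))

lemma contDiffOn_locFlux (hW : ContDiffOn ℝ (⊤ : ℕ∞) W unitCyl) :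
    ContDiffOn ℝ (⊤ : ℕ∞) (locFlux K₁ K₂ W) unitCyl := by
  have ha := hW.dirDeriv isOpen_unitCyl (0, 1)
  have hp := hW.dirDeriv isOpen_unitCyl (1, 0)
  have hq := hp.dirDeriv isOpen_unitCyl (0, 1)
  have hr := hp.dirDeriv isOpen_unitCyl (1, 0)
  unfold locFlux
  have h1 : ContDiffOn ℝ (⊤ : ℕ∞) (fun z : ℝ × ℝ => z.1 + 1 / 2) unitCyl :=
    (contDiff_fst.add contDiff_const).contDiffOn
  have h2 : ContDiffOn ℝ (⊤ : ℕ∞) (fun z : ℝ × ℝ => 1 - 4 * z.2 ^ 2) unitCyl :=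
    (contDiff_const.sub (contDiff_const.mul (contDiff_snd.pow 2))).contDiffOn
  exact ((((contDiffOn_const.mul h1).mul (h2.pow 2)).mul (ha.inner ℝ hp)).add
    (((contDiffOn_const.mul (h1.pow 2)).mul (h2.pow 4)).mul (hp.inner ℝ hq))).add
    (((h1.pow 3).mul (h2.pow 6)).mul (hq.inner ℝ hr))

lemma divergence_locDensity_le [CompleteSpace E] (hV : ContDiff ℝ (⊤ : ℕ∞) V) (hV0 : ∀ y, 0 ≤ V y)
    (hVg : ∀ y, HasGradientAt V (g y) y) (hg : ContDiff ℝ (⊤ : ℕ∞) g) {Λ : ℝ} (hΛ : 0 ≤ Λ)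
    (hK₂ : K₂ = 580) (hK₁ : K₁ = 2 * (580 * (129 + Λ) + Λ ^ 2))
    (hW : ContDiffOn ℝ (⊤ : ℕ∞) W unitCyl)
    (hpde : ∀ z ∈ unitCyl,
      dirDeriv (0, 1) (dirDeriv (0, 1) W) z = dirDeriv (1, 0) W z + g (W z))
    (hgΛ : ∀ z ∈ unitCyl, ‖fderiv ℝ g (W z)‖ ≤ Λ)
    {z : ℝ × ℝ} (hz : z ∈ unitCyl) (hz1 : -(1 / 2) ≤ z.1) (hz2 : z.2 ∈ Icc (-(1 / 2) : ℝ) (1 / 2)) :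
    dirDeriv (1, 0) (locDensity K₁ K₂ V W) z - dirDeriv (0, 1) (locFlux K₁ K₂ W) z
      ≤ 65 * K₁ * (‖dirDeriv (0, 1) W z‖ ^ 2 / 2 + V (W z)) := by
  obtain ⟨t, x⟩ := z
  have hU := isOpen_unitCyl.mem_nhds hz
  have ha := hW.dirDeriv isOpen_unitCyl (0, 1)
  have hp := hW.dirDeriv isOpen_unitCyl (1, 0)
  have hq := hp.dirDeriv isOpen_unitCyl (0, 1)
  have hr := hp.dirDeriv isOpen_unitCyl (1, 0)
  have dW := (hW.contDiffAt hU).differentiableAt (by simp)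
  have da := (ha.contDiffAt hU).differentiableAt (by simp)
  have dp := (hp.contDiffAt hU).differentiableAt (by simp)
  have dq := (hq.contDiffAt hU).differentiableAt (by simp)
  have dr := (hr.contDiffAt hU).differentiableAt (by simp)
  have hGd := ((contDiffOn_locDensity (K₁ := K₁) (K₂ := K₂) hV hW).contDiffAt hU).differentiableAt
    (by simp)
  have hFd := ((contDiffOn_locFlux (K₁ := K₁) (K₂ := K₂) hW).contDiffAt hU).differentiableAt
    (by simp)
  have e1 : dirDeriv (1, 0) (dirDeriv (0, 1) W) (t, x) = dirDeriv (0, 1) (dirDeriv (1, 0) W) (t, x) :=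
    dirDeriv_comm (hW.contDiffAt hU) _ _
  have e2 : dirDeriv (0, 1) (dirDeriv (1, 0) (dirDeriv (1, 0) W)) (t, x)
      = dirDeriv (1, 0) (dirDeriv (0, 1) (dirDeriv (1, 0) W)) (t, x) :=
    dirDeriv_comm (hp.contDiffAt hU) _ _
  have dgW : HasFDerivAt (fun z => g (W z)) ((fderiv ℝ g (W (t, x))).comp (fderiv ℝ W (t, x)))
      (t, x) :=
    ((hg.contDiffAt.differentiableAt (by simp)).hasFDerivAt).comp (t, x) dW.hasFDerivAt
  have e3 : dirDeriv (0, 1) (dirDeriv (0, 1) (dirDeriv (1, 0) W)) (t, x)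
      = dirDeriv (1, 0) (dirDeriv (1, 0) W) (t, x)
        + fderiv ℝ g (W (t, x)) (dirDeriv (1, 0) W (t, x)) := by
    have s1 : dirDeriv (0, 1) (dirDeriv (1, 0) W) =ᶠ[𝓝 (t, x)] dirDeriv (1, 0) (dirDeriv (0, 1) W) := by
      filter_upwards [hU] with w hw
      exact dirDeriv_comm (hW.contDiffAt (isOpen_unitCyl.mem_nhds hw)) _ _
    have s2 : dirDeriv (0, 1) (dirDeriv (0, 1) W) =ᶠ[𝓝 (t, x)]
        fun z => dirDeriv (1, 0) W z + g (W z) := by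
      filter_upwards [hU] with w hw using hpde w hw
    calc dirDeriv (0, 1) (dirDeriv (0, 1) (dirDeriv (1, 0) W)) (t, x)
        = dirDeriv (0, 1) (dirDeriv (1, 0) (dirDeriv (0, 1) W)) (t, x) := by
          simp only [dirDeriv] at s1 ⊢
          rw [s1.fderiv_eq]
      _ = dirDeriv (1, 0) (dirDeriv (0, 1) (dirDeriv (0, 1) W)) (t, x) :=
          dirDeriv_comm (ha.contDiffAt hU) _ _
      _ = _ := by
          have := (dp.hasFDerivAt.fun_add dgW).fderiv
          rw [dirDeriv, s2.fderiv_eq, this]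
          rfl
  have hVW : HasDerivAt (fun τ => V (W (τ, x))) ⟪g (W (t, x)), dirDeriv (1, 0) W (t, x)⟫ t := by
    have := (hVg (W (t, x))).hasFDerivAt.comp_hasDerivAt t (hasDerivAt_fst_slice dW)
    exact this.congr_deriv (by simp)
  have hθ : HasDerivAt (fun τ : ℝ => τ + 1 / 2) 1 t := (hasDerivAt_id t).add_const _
  have hη : HasDerivAt (fun ξ : ℝ => 1 - 4 * ξ ^ 2) (-(8 * x)) x := by
    have := (((hasDerivAt_id x).pow 2).const_mul 4).const_sub 1
    refine this.congr_deriv ?_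
    simp; ring
  have hGt := ((((hθ.const_mul K₁).mul_const ((1 - 4 * x ^ 2) ^ 2)).mul
      (((hasDerivAt_fst_slice da).norm_sq.div_const 2).add hVW)).add
      ((((hθ.pow 2).const_mul K₂).mul_const ((1 - 4 * x ^ 2) ^ 4)).mul
        ((hasDerivAt_fst_slice dp).norm_sq.div_const 2))).add
      (((hθ.pow 3).mul_const ((1 - 4 * x ^ 2) ^ 6)).mul
        ((hasDerivAt_fst_slice dq).norm_sq.div_const 2))
  have hFx := ((((hη.pow 2).const_mul (K₁ * (t + 1 / 2))).mul
      ((hasDerivAt_snd_slice da).inner ℝ (hasDerivAt_snd_slice dp))).add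
      (((hη.pow 4).const_mul (K₂ * (t + 1 / 2) ^ 2)).mul
      ((hasDerivAt_snd_slice dp).inner ℝ (hasDerivAt_snd_slice dq)))).add
      (((hη.pow 6).const_mul ((t + 1 / 2) ^ 3)).mul
      ((hasDerivAt_snd_slice dq).inner ℝ (hasDerivAt_snd_slice dr)))
  have hG := (hasDerivAt_fst_slice hGd).unique hGt
  have hF := (hasDerivAt_snd_slice hFd).unique hFx
  rw [hG, hF, e1, e2, e3, hpde _ hz]
  simp only [Pi.add_apply, Pi.pow_apply, Nat.cast_ofNat]
  obtain ⟨hx1, hx2⟩ := hz2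
  have hx : x ^ 2 ≤ 1 / 4 := by
    simp only at hx1 hx2
    nlinarith
  have hh : ‖fderiv ℝ g (W (t, x)) (dirDeriv (1, 0) W (t, x))‖ ≤ Λ * ‖dirDeriv (1, 0) W (t, x)‖ :=
    (ContinuousLinearMap.le_opNorm _ _).trans (by gcongr; exact hgΛ _ hz)
  have hb := dissipation_bound (θ := t + 1 / 2) (η := 1 - 4 * x ^ 2) (d := -(8 * x))
    (a := dirDeriv (0, 1) W (t, x)) (p := dirDeriv (1, 0) W (t, x))
    (q := dirDeriv (0, 1) (dirDeriv (1, 0) W) (t, x))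
    (r := dirDeriv (1, 0) (dirDeriv (1, 0) W) (t, x))
    (by simp only at hz1; linarith) (by have := hz.1.2; simp only at this; linarith)
    (by linarith) (by linarith [sq_nonneg x]) (by linarith) (hV0 (W (t, x))) hh hΛ hK₂ hK₁
  refine le_trans (le_of_eq ?_) hb
  generalize fderiv ℝ g (W (t, x)) (dirDeriv (1, 0) W (t, x)) = h
  generalize dirDeriv (1, 0) (dirDeriv (0, 1) (dirDeriv (1, 0) W)) (t, x) = qt
  generalize dirDeriv (1, 0) (dirDeriv (1, 0) W) (t, x) = r
  generalize dirDeriv (0, 1) (dirDeriv (1, 0) W) (t, x) = q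
  generalize dirDeriv (1, 0) W (t, x) = p
  generalize dirDeriv (0, 1) W (t, x) = a
  generalize V (W (t, x)) = v
  generalize g (W (t, x)) = γ
  simp only [inner_add_left, inner_add_right, real_inner_self_eq_norm_sq,
    real_inner_comm r h, real_inner_comm q a, real_inner_comm qt q, real_inner_comm r q,
    real_inner_comm r p, real_inner_comm p γ]
  ring
end

lemma interior_estimate [CompleteSpace E] {V : E → ℝ} {g : E → E} (hV : ContDiff ℝ (⊤ : ℕ∞) V)
    (hV0 : ∀ y, 0 ≤ V y) (hVg : ∀ y, HasGradientAt V (g y) y) (hg : ContDiff ℝ (⊤ : ℕ∞) g)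
    {c Λ : ℝ} (hc : 0 < c) (hΛ : 0 < Λ) :
    ∃ K > (0 : ℝ), ∀ (σ : E) (W : ℝ × ℝ → E), ContDiffOn ℝ (⊤ : ℕ∞) W unitCyl →
      (∀ z ∈ unitCyl, dirDeriv (0, 1) (dirDeriv (0, 1) W) z = dirDeriv (1, 0) W z + g (W z)) →
      (∀ z ∈ unitCyl, c * ‖W z - σ‖ ^ 2 ≤ V (W z) ∧ V (W z) ≤ Λ * ‖W z - σ‖ ^ 2 ∧
        ‖g (W z)‖ ≤ Λ * ‖W z - σ‖ ∧ ‖fderiv ℝ g (W z)‖ ≤ Λ) →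
      ∀ T ∈ Ioo (-(1 / 4) : ℝ) 0,
        ‖dirDeriv (1, 0) W (T, 0)‖ ^ 2 + (‖dirDeriv (0, 1) W (T, 0)‖ ^ 2 / 2 + V (W (T, 0)))
          ≤ K * ∫ z in Icc (-(1 / 2)) T ×ˢ Icc (-(1 / 2)) (1 / 2),
              (‖dirDeriv (0, 1) W z‖ ^ 2 / 2 + V (W z)) := by
  obtain ⟨K₁, hK₁⟩ : ∃ K₁, K₁ = 2 * (580 * (129 + Λ) + Λ ^ 2) := ⟨_, rfl⟩
  obtain ⟨K₂, hK₂⟩ : ∃ K₂ : ℝ, K₂ = 580 := ⟨_, rfl⟩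
  have hK₁1 : 1 ≤ K₁ := by rw [hK₁]; nlinarith
  have hK₂1 : 1 ≤ K₂ := by rw [hK₂]; norm_num
  obtain ⟨C, hC⟩ : ∃ C, C = 64 * (60 + (30 + Λ ^ 2) / c) := ⟨_, rfl⟩
  have hC0 : 0 < C := by rw [hC]; positivity
  refine ⟨(1 + Λ) * (C * (65 * K₁)), by positivity, fun σ W hW hpde hb T hT => ?_⟩
  have hrect : Icc (-(1 / 2)) T ×ˢ Icc (-(1 / 2) : ℝ) (1 / 2) ⊆ unitCyl := by
    rintro ⟨t, x⟩ ⟨⟨h1, h2⟩, h3, h4⟩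
    have := hT.2
    simp only at h1 h2 h3 h4
    exact ⟨⟨by simp only; linarith, by simp only; linarith⟩,
      by simp only; linarith, by simp only; linarith⟩
  have hslice : ∀ x ∈ Icc (-(1 / 2) : ℝ) (1 / 2), (T, x) ∈ unitCyl := fun x hx =>
    hrect ⟨⟨by linarith [hT.1], le_rfl⟩, hx⟩
  have ha := hW.dirDeriv isOpen_unitCyl (0, 1)
  have hp := hW.dirDeriv isOpen_unitCyl (1, 0)
  have hG := contDiffOn_locDensity (K₁ := K₁) (K₂ := K₂) hV hW
  have h1 : ∫ x in (-(1 / 2))..(1 / 2), locDensity K₁ K₂ V W (T, x)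
      ≤ ∫ z in Icc (-(1 / 2)) T ×ˢ Icc (-(1 / 2)) (1 / 2),
          65 * K₁ * (‖dirDeriv (0, 1) W z‖ ^ 2 / 2 + V (W z)) := by
    refine integral_slice_le_of_divergence_le isOpen_unitCyl hG
      (contDiffOn_locFlux (K₁ := K₁) (K₂ := K₂) hW) ?_ (by linarith [hT.1]) (by norm_num) hrect
      (fun z hz => divergence_locDensity_le hV hV0 hVg hg hΛ.le hK₂ hK₁ hW hpde
        (fun z hz => (hb z hz).2.2.2) (hrect hz) hz.1.1 hz.2) ?_ ?_ ?_
    · exact continuousOn_const.mul (((ha.continuousOn.norm.pow 2).div_const 2).add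
        (hV.continuous.comp_continuousOn hW.continuousOn))
    · intro x; norm_num [locDensity]
    · intro t; norm_num [locFlux]
    · intro t; norm_num [locFlux]
  rw [integral_const_mul] at h1
  have hGnn : ∀ x, 0 ≤ locDensity K₁ K₂ V W (T, x) := by
    intro x
    have h2 : 0 ≤ T + 1 / 2 := by linarith [hT.1]
    have := hV0 (W (T, x))
    have e4 : (0 : ℝ) ≤ (1 - 4 * x ^ 2) ^ 4 := Even.pow_nonneg (by decide) _
    have e6 : (0 : ℝ) ≤ (1 - 4 * x ^ 2) ^ 6 := Even.pow_nonneg (by decide) _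
    simp only [locDensity]
    positivity
  have hGc : ContinuousOn (fun x => locDensity K₁ K₂ V W (T, x)) (Icc (-(1 / 2)) (1 / 2)) :=
    hG.continuousOn.comp (by fun_prop) hslice
  have h2 : ‖W (T, 0) - σ‖ ^ 2 + ‖dirDeriv (0, 1) W (T, 0)‖ ^ 2 + ‖dirDeriv (1, 0) W (T, 0)‖ ^ 2
      ≤ ∫ x in (0 : ℝ)..(1 / 2), C * locDensity K₁ K₂ V W (T, x) := by
    have hder : ∀ x ∈ Icc (0 : ℝ) (1 / 2), HasDerivAt
        (fun x => -((1 - 4 * x ^ 2) ^ 6 * (‖W (T, x) - σ‖ ^ 2 + ‖dirDeriv (0, 1) W (T, x)‖ ^ 2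
          + ‖dirDeriv (1, 0) W (T, x)‖ ^ 2)))
        (-(6 * (1 - 4 * x ^ 2) ^ 5 * (-(8 * x)) * (‖W (T, x) - σ‖ ^ 2
          + ‖dirDeriv (0, 1) W (T, x)‖ ^ 2 + ‖dirDeriv (1, 0) W (T, x)‖ ^ 2)
          + 2 * (1 - 4 * x ^ 2) ^ 6 * (⟪W (T, x) - σ, dirDeriv (0, 1) W (T, x)⟫
            + ⟪dirDeriv (0, 1) W (T, x), dirDeriv (1, 0) W (T, x) + g (W (T, x))⟫
            + ⟪dirDeriv (1, 0) W (T, x), dirDeriv (0, 1) (dirDeriv (1, 0) W) (T, x)⟫))) x := by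
      intro x hx
      have hmem := hslice x ⟨by linarith [hx.1], hx.2⟩
      have hU := isOpen_unitCyl.mem_nhds hmem
      have dW := (hW.contDiffAt hU).differentiableAt (by simp)
      have da := (ha.contDiffAt hU).differentiableAt (by simp)
      have dp := (hp.contDiffAt hU).differentiableAt (by simp)
      have hη : HasDerivAt (fun ξ : ℝ => 1 - 4 * ξ ^ 2) (-(8 * x)) x := by
        have := (((hasDerivAt_id x).pow 2).const_mul 4).const_sub 1
        refine this.congr_deriv ?_
        simp; ring
      have := ((hη.pow 6).mul ((((hasDerivAt_snd_slice dW).sub_const σ).norm_sq.add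
        (hasDerivAt_snd_slice da).norm_sq).add (hasDerivAt_snd_slice dp).norm_sq)).neg
      refine this.congr_deriv ?_
      rw [hpde _ hmem]
      simp only [Pi.add_apply, Pi.pow_apply, Nat.cast_ofNat]
      ring
    have := intervalIntegral.sub_le_integral_of_hasDeriv_right_of_le (show (0 : ℝ) ≤ 1 / 2 by norm_num)
      (fun x hx => (hder x hx).continuousAt.continuousWithinAt)
      (fun x hx => (hder x (Ioo_subset_Icc_self hx)).hasDerivWithinAt)
      (φ := fun x => C * locDensity K₁ K₂ V W (T, x))
      ((continuousOn_const.mul (hGc.mono (Icc_subset_Icc_left (by norm_num)))).integrableOn_Icc)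
      (fun x hx => ?_)
    · norm_num at this
      norm_num
      linarith
    · have hmem := hslice x ⟨by linarith [hx.1], hx.2.le⟩
      have hx2 : x ^ 2 ≤ 1 / 4 := by nlinarith [hx.1, hx.2]
      rw [hC]
      exact slice_bound (by linarith [hT.1]) (by linarith) (by nlinarith)
        (by rw [abs_le]; constructor <;> linarith [hx.1, hx.2]) hc (hb _ hmem).1
        (hb _ hmem).2.2.1 hK₁1 hK₂1
  have h3 : ∫ x in (0 : ℝ)..(1 / 2), C * locDensity K₁ K₂ V W (T, x)
      ≤ C * ∫ x in (-(1 / 2))..(1 / 2), locDensity K₁ K₂ V W (T, x) := by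
    rw [intervalIntegral.integral_const_mul]
    refine mul_le_mul_of_nonneg_left ?_ hC0.le
    refine intervalIntegral.integral_mono_interval (by norm_num) (by norm_num) le_rfl
      (Eventually.of_forall hGnn) ?_
    exact ContinuousOn.intervalIntegrable (by rwa [uIcc_of_le (by norm_num)])
  have hVu := (hb _ (hslice 0 (by constructor <;> norm_num))).2.1
  have h4 := h2.trans (h3.trans (mul_le_mul_of_nonneg_left h1 hC0.le))
  have h5 := mul_le_mul_of_nonneg_left h4 (show 0 ≤ 1 + Λ by linarith)
  have := mul_nonneg hΛ.le (sq_nonneg ‖dirDeriv (0, 1) W (T, 0)‖)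
  have := mul_nonneg hΛ.le (sq_nonneg ‖dirDeriv (1, 0) W (T, 0)‖)
  nlinarith [sq_nonneg ‖dirDeriv (0, 1) W (T, 0)‖, sq_nonneg ‖W (T, 0) - σ‖]

end

lemma MultiWell.contDiff_gradient (P : MultiWell k) : ContDiff ℝ (⊤ : ℕ∞) (gradient P.V) :=
  (InnerProductSpace.toDual ℝ (Euc k)).symm.contDiff.comp (P.smooth.fderiv_right (by simp))

lemma MultiWell.hasGradientAt (P : MultiWell k) (y : Euc k) :
    HasGradientAt P.V (gradient P.V y) y :=
  (P.smooth.contDiffAt.differentiableAt (by simp)).hasGradientAt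

lemma MultiWell.gradient_well (P : MultiWell k) {σ : Euc k} (hσ : σ ∈ P.wells) :
    gradient P.V σ = 0 := by
  have : IsLocalMin P.V σ := Eventually.of_forall fun y => by
    rw [(P.zero_iff σ).2 hσ]; exact P.nonneg y
  rw [gradient, this.fderiv_eq_zero, map_zero]

lemma half_mul_sq_le_of_deriv2_ge {φ φ' φ'' : ℝ → ℝ} {m : ℝ}
    (h1 : ∀ t, HasDerivAt φ (φ' t) t) (h2 : ∀ t, HasDerivAt φ' (φ'' t) t)
    (hm : ∀ t ∈ Icc (0 : ℝ) 1, m ≤ φ'' t) (h0 : φ 0 = 0) (h0' : φ' 0 = 0) : m / 2 ≤ φ 1 := by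
  have d2 : ∀ t, HasDerivAt (fun t => φ' t - m * t) (φ'' t - m) t := fun t => by
    exact ((h2 t).sub ((hasDerivAt_id t).const_mul m)).congr_deriv (by simp)
  have m2 : MonotoneOn (fun t => φ' t - m * t) (Icc 0 1) := by
    refine monotoneOn_of_deriv_nonneg (convex_Icc 0 1)
      (fun t _ => (d2 t).continuousAt.continuousWithinAt)
      (fun t _ => (d2 t).differentiableAt.differentiableWithinAt) fun t ht => ?_
    rw [(d2 t).deriv]
    linarith [hm t (interior_subset ht)]
  have d1 : ∀ t, HasDerivAt (fun t => φ t - m / 2 * t ^ 2) (φ' t - m * t) t := fun t => by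
    refine ((h1 t).sub (((hasDerivAt_id t).pow 2).const_mul (m / 2))).congr_deriv ?_
    simp; ring
  have m1 : MonotoneOn (fun t => φ t - m / 2 * t ^ 2) (Icc 0 1) := by
    refine monotoneOn_of_deriv_nonneg (convex_Icc 0 1)
      (fun t _ => (d1 t).continuousAt.continuousWithinAt)
      (fun t _ => (d1 t).differentiableAt.differentiableWithinAt) fun t ht => ?_
    rw [(d1 t).deriv]
    have ht' := interior_subset ht
    have := m2 (left_mem_Icc.2 zero_le_one) ht' ht'.1
    simpa [h0'] using this
  have := m1 (left_mem_Icc.2 zero_le_one) (right_mem_Icc.2 zero_le_one) zero_le_one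
  simp [h0] at this
  linarith

lemma GoodRadius.exists_well_bounds {P : MultiWell k} {μ₀ : ℝ} (hμ : GoodRadius P μ₀)
    {σ : Euc k} (hσ : σ ∈ P.wells) :
    ∃ c > (0 : ℝ), ∃ Λ > (0 : ℝ), ∀ y ∈ ball σ μ₀,
      c * ‖y - σ‖ ^ 2 ≤ P.V y ∧ P.V y ≤ Λ * ‖y - σ‖ ^ 2 ∧
        ‖gradient P.V y‖ ≤ Λ * ‖y - σ‖ ∧ ‖fderiv ℝ (gradient P.V) y‖ ≤ Λ := by
  obtain ⟨C, hC⟩ := (isCompact_closedBall σ μ₀).exists_bound_of_continuousOn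
    (P.contDiff_gradient.continuous_fderiv (by simp)).continuousOn
  have hV0 : P.V σ = 0 := (P.zero_iff σ).2 hσ
  have hσb : σ ∈ ball σ μ₀ := mem_ball_self hμ.1
  set Λ := |C| + 1 with hΛ
  have hfd : ∀ y ∈ ball σ μ₀, ‖fderiv ℝ (gradient P.V) y‖ ≤ Λ := fun y hy =>
    (hC y (ball_subset_closedBall hy)).trans (by linarith [le_abs_self C])
  have hgr : ∀ y ∈ ball σ μ₀, ‖gradient P.V y‖ ≤ Λ * ‖y - σ‖ := fun y hy => by
    have := Convex.norm_image_sub_le_of_norm_fderiv_le (𝕜 := ℝ)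
      (fun x _ => P.contDiff_gradient.contDiffAt.differentiableAt (by simp)) hfd
      (convex_ball σ μ₀) hσb hy
    rwa [P.gradient_well hσ, sub_zero] at this
  have hΛ0 : 0 < Λ := by positivity
  refine ⟨P.lamm σ / 2 / 2, by linarith [P.lamm_pos σ hσ], Λ, hΛ0, fun y hy =>
    ⟨?_, ?_, hgr y hy, hfd y hy⟩⟩
  · have hline : ∀ t : ℝ, HasDerivAt (fun t : ℝ => σ + t • (y - σ)) (y - σ) t := fun t => by
      simpa using ((hasDerivAt_id t).smul_const (y - σ)).const_add σ
    have hmem : ∀ t ∈ Icc (0 : ℝ) 1, σ + t • (y - σ) ∈ ball σ μ₀ := fun t ht =>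
      (convex_ball σ μ₀).add_smul_sub_mem hσb hy ht
    have := half_mul_sq_le_of_deriv2_ge (φ := fun t => P.V (σ + t • (y - σ)))
      (φ' := fun t => fderiv ℝ P.V (σ + t • (y - σ)) (y - σ))
      (φ'' := fun t => fderiv ℝ (fderiv ℝ P.V) (σ + t • (y - σ)) (y - σ) (y - σ))
      (m := P.lamm σ / 2 * ‖y - σ‖ ^ 2)
      (fun t => ((P.smooth.contDiffAt.differentiableAt (by simp)).hasFDerivAt).comp_hasDerivAt t
        (hline t))
      (fun t => by
        have hd : DifferentiableAt ℝ (fderiv ℝ P.V) (σ + t • (y - σ)) :=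
          (P.smooth.fderiv_right (m := (⊤ : ℕ∞)) (by simp)).contDiffAt.differentiableAt (by simp)
        exact (ContinuousLinearMap.apply ℝ ℝ (y - σ)).hasFDerivAt.comp_hasDerivAt t
          (hd.hasFDerivAt.comp_hasDerivAt t (hline t)))
      (fun t ht => by
        have := (hμ.2.2 σ hσ _ (hmem t ht) (y - σ)).1
        simpa [iteratedFDeriv_two_apply] using this)
      (by simpa using hV0)
      (by
        have hl : IsLocalMin P.V σ := Eventually.of_forall fun y => by
          rw [hV0]; exact P.nonneg y
        simp [hl.fderiv_eq_zero])
    simp only [one_smul, add_sub_cancel] at this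
    linarith
  · have hsub : closedBall σ ‖y - σ‖ ⊆ ball σ μ₀ :=
      closedBall_subset_ball (by rwa [← dist_eq_norm])
    have := Convex.norm_image_sub_le_of_norm_fderiv_le (𝕜 := ℝ) (f := P.V)
      (C := Λ * ‖y - σ‖) (s := closedBall σ ‖y - σ‖) (x := σ) (y := y)
      (fun x _ => P.smooth.contDiffAt.differentiableAt (by simp))
      (fun x hx => by
        have h1 : ‖fderiv ℝ P.V x‖ = ‖gradient P.V x‖ := by
          rw [gradient, LinearIsometryEquiv.norm_map]
        rw [h1]
        refine (hgr x (hsub hx)).trans ?_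
        gcongr
        simpa [dist_eq_norm] using hx)
      (convex_closedBall _ _) (mem_closedBall_self (norm_nonneg _))
      (by simp [dist_eq_norm])
    rw [hV0, sub_zero] at this
    calc P.V y ≤ ‖P.V y‖ := Real.le_norm_self _
      _ ≤ _ := this
      _ = _ := by ring

/-- The closed cylinder `[-1, 0] × [-1, 1]`, time being the first coordinate. -/
def closedUnitCyl : Set (ℝ × ℝ) := Icc (-1) 0 ×ˢ Icc (-1) 1

lemma unitCyl_subset : unitCyl ⊆ closedUnitCyl :=
  Set.prod_mono Ioo_subset_Icc_self Ioo_subset_Icc_self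

lemma isCompact_closedUnitCyl : IsCompact closedUnitCyl := isCompact_Icc.prod isCompact_Icc

lemma unit_estimate {P : MultiWell k} {μ₀ : ℝ} (hμ : GoodRadius P μ₀)
    {σ : Euc k} (hσ : σ ∈ P.wells) :
    ∃ K > (0 : ℝ), ∀ w : ℝ → ℝ → Euc k,
      ContDiffOn ℝ (⊤ : ℕ∞) (Function.uncurry w) closedUnitCyl →
      (∀ t ∈ Ioo (-1 : ℝ) 0, ∀ x ∈ Ioo (-1 : ℝ) 1,
        deriv (fun τ => w τ x) t - iteratedDeriv 2 (w t) x = -gradient P.V (w t x)) →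
      (∀ t ∈ Ioo (-1 : ℝ) 0, ∀ x ∈ Ioo (-1 : ℝ) 1, w t x ∈ ball σ μ₀) →
      0 ≤ ∫ t in (-1)..0, ∫ x in (-1)..1, eDen P 1 (w t) x ∧
      ‖deriv (fun t => w t 0) 0‖ ^ 2 + eDen P 1 (w 0) 0
        ≤ K * ∫ t in (-1)..0, ∫ x in (-1)..1, eDen P 1 (w t) x := by
  obtain ⟨c, hc, Λ, hΛ, hb⟩ := hμ.exists_well_bounds hσ
  obtain ⟨K, hK, hest⟩ := interior_estimate P.smooth P.nonneg P.hasGradientAt P.contDiff_gradient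
    hc hΛ
  refine ⟨K, hK, fun w hw hpde hball => ?_⟩
  set W := Function.uncurry w with hWdef
  set D := fderivWithin ℝ W closedUnitCyl with hD
  have hDc : ContinuousOn D closedUnitCyl := hw.continuousOn_fderivWithin
    ((uniqueDiffOn_Icc (by norm_num)).prod (uniqueDiffOn_Icc (by norm_num))) (by simp)
  have hDf : ∀ z ∈ unitCyl, D z = fderiv ℝ W z := fun z hz =>
    fderivWithin_of_mem_nhds (mem_of_superset (isOpen_unitCyl.mem_nhds hz) unitCyl_subset)
  have hWi : ContDiffOn ℝ (⊤ : ℕ∞) W unitCyl := hw.mono unitCyl_subset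
  have hxder : ∀ t ∈ Icc (-1 : ℝ) 0, ∀ x ∈ Ioo (-1 : ℝ) 1, HasDerivAt (w t) (D (t, x) (0, 1)) x := by
    intro t ht x hx
    have h1 : HasFDerivWithinAt W (D (t, x)) closedUnitCyl (t, x) :=
      (hw.differentiableOn (by simp) _ ⟨ht, Ioo_subset_Icc_self hx⟩).hasFDerivWithinAt
    have h2 : HasDerivWithinAt (fun ξ : ℝ => ((t, ξ) : ℝ × ℝ)) (0, 1) (Icc (-1) 1) x :=
      ((hasDerivAt_const x t).prodMk (hasDerivAt_id x)).hasDerivWithinAt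
    exact (h1.comp_hasDerivWithinAt x h2 fun ξ hξ => ⟨ht, hξ⟩).hasDerivAt (Icc_mem_nhds hx.1 hx.2)
  have hpde' : ∀ z ∈ unitCyl, dirDeriv (0, 1) (dirDeriv (0, 1) W) z
      = dirDeriv (1, 0) W z + gradient P.V (W z) := by
    rintro ⟨t, x⟩ hz
    have hU := isOpen_unitCyl.mem_nhds hz
    have h1 : deriv (fun τ => w τ x) t = dirDeriv (1, 0) W (t, x) :=
      (hasDerivAt_fst_slice ((hWi.contDiffAt hU).differentiableAt (by simp))).deriv
    have h2 : iteratedDeriv 2 (w t) x = dirDeriv (0, 1) (dirDeriv (0, 1) W) (t, x) := by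
      have e : deriv (w t) =ᶠ[𝓝 x] fun ξ => dirDeriv (0, 1) W (t, ξ) := by
        filter_upwards [Ioo_mem_nhds hz.2.1 hz.2.2] with ξ hξ
        have hm : ((t, ξ) : ℝ × ℝ) ∈ unitCyl := ⟨hz.1, hξ⟩
        rw [(hxder t (Ioo_subset_Icc_self hz.1) ξ hξ).deriv, hDf _ hm, dirDeriv]
      rw [iteratedDeriv_succ, iteratedDeriv_one, e.deriv_eq]
      exact (hasDerivAt_snd_slice (((hWi.dirDeriv isOpen_unitCyl _).contDiffAt
        hU).differentiableAt (by simp))).deriv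
    have h3 := hpde t hz.1 x hz.2
    rw [h1, h2, sub_eq_iff_eq_add] at h3
    rw [h3]
    simp [hWdef]
  set e : ℝ × ℝ → ℝ := fun z => ‖D z (0, 1)‖ ^ 2 / 2 + P.V (W z) with he
  have hec : ContinuousOn e closedUnitCyl :=
    (((hDc.clm_apply continuousOn_const).norm.pow 2).div_const 2).add
      (P.smooth.continuous.comp_continuousOn hw.continuousOn)
  have hei : IntegrableOn e closedUnitCyl := hec.integrableOn_compact isCompact_closedUnitCyl
  have he0 : ∀ z, 0 ≤ e z := fun z => add_nonneg (by positivity) (P.nonneg _)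
  have hden : ∀ t ∈ Icc (-1 : ℝ) 0, ∀ x ∈ Ioo (-1 : ℝ) 1, eDen P 1 (w t) x = e (t, x) := by
    intro t ht x hx
    rw [eDen, (hxder t ht x hx).deriv, he]
    simp [hWdef]
  have hfubini : ∫ t in (-1)..0, ∫ x in (-1)..1, eDen P 1 (w t) x = ∫ z in closedUnitCyl, e z := by
    rw [intervalIntegral.integral_of_le (by norm_num), ← integral_Icc_eq_integral_Ioc,
      closedUnitCyl, Measure.volume_eq_prod, setIntegral_prod e hei]
    refine setIntegral_congr_fun measurableSet_Icc fun t ht => ?_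
    rw [intervalIntegral.integral_of_le (by norm_num), integral_Ioc_eq_integral_Ioo,
      integral_Icc_eq_integral_Ioo]
    exact setIntegral_congr_fun measurableSet_Ioo fun x hx => hden t ht x hx
  rw [hfubini]
  refine ⟨setIntegral_nonneg isCompact_closedUnitCyl.measurableSet fun z _ => he0 z, ?_⟩
  have hmap : MapsTo (fun T : ℝ => ((T, 0) : ℝ × ℝ)) (Icc (-(1 / 4)) 0) closedUnitCyl :=
    fun T hT => ⟨⟨by linarith [hT.1], hT.2⟩, by norm_num, by norm_num⟩
  have hcl : closure (Ioo (-(1 / 4) : ℝ) 0) = Icc (-(1 / 4)) 0 := closure_Ioo (by norm_num)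
  have hlim : ‖D (0, 0) (1, 0)‖ ^ 2 + e (0, 0) ≤ K * ∫ z in closedUnitCyl, e z := by
    refine le_on_closure (s := Ioo (-(1 / 4) : ℝ) 0)
      (f := fun T => ‖D (T, 0) (1, 0)‖ ^ 2 + e (T, 0)) (g := fun _ => K * ∫ z in closedUnitCyl, e z)
      (fun T hT => ?_) ?_ continuousOn_const (by rw [hcl]; constructor <;> norm_num)
    · have hT0 : ((T, 0) : ℝ × ℝ) ∈ unitCyl :=
        ⟨⟨by linarith [hT.1], hT.2⟩, by norm_num, by norm_num⟩
      have hrect : Icc (-(1 / 2)) T ×ˢ Icc (-(1 / 2) : ℝ) (1 / 2) ⊆ unitCyl :=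
        Set.prod_mono (Icc_subset_Ioo (by norm_num) hT.2) (Icc_subset_Ioo (by norm_num) (by norm_num))
      have h1 := hest σ W hWi hpde' (fun z hz => hb _ (hball _ hz.1 _ hz.2)) T hT
      have h2 : ∫ z in Icc (-(1 / 2)) T ×ˢ Icc (-(1 / 2)) (1 / 2),
            (‖dirDeriv (0, 1) W z‖ ^ 2 / 2 + P.V (W z))
          = ∫ z in Icc (-(1 / 2)) T ×ˢ Icc (-(1 / 2)) (1 / 2), e z :=
        setIntegral_congr_fun (measurableSet_Icc.prod measurableSet_Icc) fun z hz => by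
          simp only [he, hDf z (hrect hz), dirDeriv]
      rw [h2] at h1
      simp only [he, hDf _ hT0]
      refine h1.trans (mul_le_mul_of_nonneg_left ?_ hK.le)
      exact setIntegral_mono_set hei (Eventually.of_forall he0)
        (hrect.trans unitCyl_subset).eventuallyLE
    · rw [hcl]
      have hm : ContinuousOn (fun T : ℝ => ((T, 0) : ℝ × ℝ)) (Icc (-(1 / 4)) 0) := by fun_prop
      exact (((hDc.comp hm hmap).clm_apply continuousOn_const).norm.pow 2).add (hec.comp hm hmap)
  have h0 : (0 : ℝ) ∈ Icc (-1 : ℝ) 0 := by constructor <;> norm_num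
  rw [hden 0 h0 0 (by constructor <;> norm_num)]
  refine le_trans (add_le_add_left ?_ _) hlim
  have hnorm : ‖deriv (fun t => w t 0) 0‖ ≤ ‖D (0, 0) (1, 0)‖ := by
    by_cases hdiff : DifferentiableAt ℝ (fun t => w t 0) 0
    · have h1 : HasFDerivWithinAt W (D (0, 0)) closedUnitCyl (0, 0) :=
        (hw.differentiableOn (by simp) _
          (hmap (right_mem_Icc.2 (by norm_num)))).hasFDerivWithinAt
      have h2 : HasDerivWithinAt (fun τ : ℝ => ((τ, 0) : ℝ × ℝ)) (1, 0) (Icc (-1) 0) 0 :=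
        ((hasDerivAt_id (0 : ℝ)).prodMk (hasDerivAt_const (0 : ℝ) (0 : ℝ))).hasDerivWithinAt
      have h3 : HasDerivWithinAt (fun τ => w τ 0) (D (0, 0) (1, 0)) (Icc (-1) 0) 0 :=
        HasFDerivWithinAt.comp_hasDerivWithinAt (f := fun τ : ℝ => ((τ, 0) : ℝ × ℝ)) 0 h1 h2
          fun τ hτ => ⟨hτ, by norm_num, by norm_num⟩
      rw [((uniqueDiffOn_Icc (by norm_num)) 0 h0).eq_deriv _ hdiff.hasDerivAt.hasDerivWithinAt h3]
    · rw [deriv_zero_of_not_differentiableAt hdiff, norm_zero]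
      exact norm_nonneg _
  gcongr

lemma deriv_comp_const_add_mul (f : ℝ → Euc k) (a b x : ℝ) :
    deriv (fun x => f (a + b * x)) x = b • deriv f (a + b * x) := by
  rw [deriv_comp_mul_left b (fun x => f (a + x)), deriv_comp_const_add]

lemma eDen_rescale (P : MultiWell k) {ε : ℝ} (hε : 0 < ε) (u : ℝ → Euc k) (y x : ℝ) :
    eDen P 1 (fun x => u (y + ε * x)) x = ε * eDen P ε u (y + ε * x) := by
  simp only [eDen, deriv_comp_const_add_mul, norm_smul, mul_pow, Real.norm_eq_abs, sq_abs]
  field_simp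

lemma integral_eDen_rescale (P : MultiWell k) {ε : ℝ} (hε : 0 < ε) (v : ℝ → ℝ → Euc k) (y s : ℝ) :
    ∫ t in (-1)..0, ∫ x in (-1)..1, eDen P 1 (fun x => v (s + ε ^ 2 * t) (y + ε * x)) x
      = (ε ^ 2)⁻¹ * ∫ τ in (s - ε ^ 2)..s, ∫ z in (y - ε)..(y + ε), eDen P ε (v τ) z := by
  have h1 : ∀ τ, ∫ x in (-1)..1, eDen P 1 (fun x => v τ (y + ε * x)) x
      = ∫ z in (y - ε)..(y + ε), eDen P ε (v τ) z := by
    intro τ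
    simp only [eDen_rescale P hε]
    rw [intervalIntegral.integral_const_mul,
      intervalIntegral.integral_comp_add_mul (eDen P ε (v τ)) hε.ne' y, smul_eq_mul,
      ← mul_assoc, mul_inv_cancel₀ hε.ne', one_mul]
    congr 1 <;> ring
  simp only [h1]
  rw [intervalIntegral.integral_comp_add_mul
    (fun τ => ∫ z in (y - ε)..(y + ε), eDen P ε (v τ) z) (pow_pos hε 2).ne' s, smul_eq_mul]
  congr 2 <;> ring

/-- parabolic regularization: there is `K' > 0` depending only on `V` such
that for a solution on the cylinder `[y−ε, y+ε] × [s−ε², s]` taking values in a well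
`B(σ, μ₀)`, `ε⁴|∂ₜv_ε(y,s)|² + ε e_ε(v_ε(y,s)) ≤ K'ε⁻² ∬ e_ε(v_ε)`. -/
theorem parabolic_regularization (P : MultiWell k) (μ₀ : ℝ) (hμ : GoodRadius P μ₀) :
    ∃ K' > (0:ℝ), ∀ ε : ℝ, 0 < ε → ε ≤ 1 →
      ∀ y s : ℝ, 0 < s → ε ^ 2 ≤ s →
      ∀ v : ℝ → ℝ → Euc k,
        ContDiffOn ℝ (⊤ : ℕ∞) (Function.uncurry v) (Icc (s - ε ^ 2) s ×ˢ Icc (y - ε) (y + ε)) →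
        (∀ τ ∈ Icc (s - ε ^ 2) s, ∀ z ∈ Icc (y - ε) (y + ε),
          deriv (fun t => v t z) τ - iteratedDeriv 2 (v τ) z
            = -(ε ^ 2)⁻¹ • gradient P.V (v τ z)) →
      ∀ σ ∈ P.wells,
        (∀ τ ∈ Icc (s - ε ^ 2) s, ∀ z ∈ Icc (y - ε) (y + ε), v τ z ∈ ball σ μ₀) →
        ε ^ 4 * ‖deriv (fun t => v t y) s‖ ^ 2 + ε * eDen P ε (v s) y
          ≤ K' * (ε ^ 2)⁻¹
            * ∫ τ in (s - ε ^ 2)..s, ∫ z in (y - ε)..(y + ε), eDen P ε (v τ) z := by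
  classical
  choose! K hK hest using fun σ (hσ : σ ∈ P.wells) => unit_estimate hμ hσ
  refine ⟨∑ σ ∈ P.wells, K σ, Finset.sum_pos hK
    (Finset.card_pos.1 (by linarith [P.two_le_card])), ?_⟩
  intro ε hε _ y s _ _ v hv hpde σ hσ hball
  have hε2 : 0 < ε ^ 2 := pow_pos hε 2
  have ht : ∀ t ∈ Icc (-1 : ℝ) 0, s + ε ^ 2 * t ∈ Icc (s - ε ^ 2) s := fun t ht =>
    ⟨by nlinarith [ht.1], by nlinarith [ht.2]⟩
  have hx : ∀ x ∈ Icc (-1 : ℝ) 1, y + ε * x ∈ Icc (y - ε) (y + ε) := fun x hx =>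
    ⟨by nlinarith [hx.1], by nlinarith [hx.2]⟩
  have hest' := hest σ hσ fun t x => v (s + ε ^ 2 * t) (y + ε * x)
  have hreg := hest' ?_ ?_ ?_
  · obtain ⟨hnn, hle⟩ := hreg
    rw [integral_eDen_rescale P hε] at hnn hle
    have h1 : deriv (fun t => v (s + ε ^ 2 * t) (y + ε * 0)) 0
        = ε ^ 2 • deriv (fun t => v t y) s := by
      rw [deriv_comp_const_add_mul (fun t => v t (y + ε * 0))]
      simp
    rw [h1, eDen_rescale P hε, norm_smul, Real.norm_eq_abs, abs_of_pos hε2] at hle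
    simp only [mul_zero, add_zero] at hle
    calc _ = _ := by ring
      _ ≤ _ := hle
      _ ≤ _ := mul_le_mul_of_nonneg_right
        (Finset.single_le_sum (f := K) (fun σ hσ => (hK σ hσ).le) hσ) hnn
      _ = _ := by ring
  · refine hv.comp (f := fun z : ℝ × ℝ => (s + ε ^ 2 * z.1, y + ε * z.2)) ?_
      fun z hz => ⟨ht _ hz.1, hx _ hz.2⟩
    exact (by fun_prop : ContDiff ℝ (⊤ : ℕ∞)
      fun z : ℝ × ℝ => (s + ε ^ 2 * z.1, y + ε * z.2)).contDiffOn
  · intro t ht' x hx'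
    have h := hpde _ (ht t (Ioo_subset_Icc_self ht')) _ (hx x (Ioo_subset_Icc_self hx'))
    have h2 : iteratedDeriv 2 (fun x => v (s + ε ^ 2 * t) (y + ε * x)) x
        = ε ^ 2 • iteratedDeriv 2 (v (s + ε ^ 2 * t)) (y + ε * x) := by
      have e : deriv (fun x => v (s + ε ^ 2 * t) (y + ε * x))
          = fun x => ε • deriv (v (s + ε ^ 2 * t)) (y + ε * x) :=
        funext fun x => deriv_comp_const_add_mul _ _ _ _
      rw [iteratedDeriv_succ, iteratedDeriv_one, e, iteratedDeriv_succ, iteratedDeriv_one,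
        deriv_fun_const_smul_field, deriv_comp_const_add_mul, smul_smul, sq]
    rw [h2, deriv_comp_const_add_mul (fun τ => v τ (y + ε * x)), ← smul_sub, h, smul_smul,
      mul_neg, mul_inv_cancel₀ hε2.ne', neg_one_smul]
  · exact fun t ht' x hx' =>
      hball _ (ht t (Ioo_subset_Icc_self ht')) _ (hx x (Ioo_subset_Icc_self hx'))
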